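/- Suppose G is a marked graph with two adjacent vertices v and w such that v is looped and marked, w is unlooped and unmarked, and v and w have precisely the same neighbors outside {v,w}. If v has no neighbor other than w, then ⟨G⟩ = ⟨G⁺ − v − w⟩, where G⁺ is obtained from G by adjoining one free loop. Otherwise, ⟨G⟩ = ⟨G_c^{vz} − v − w⟩ for any neighbor z ≠ w of v. -/

import Mathlib

open MvPolynomial

/-- A marked graph: a finite vertex set, an adjacency matrix over GF(2)
(the diagonal entry at `v` is 1 iff `v` carries a loop; for `v ≠ w` the `(v,w)` entry
is 1 iff `v` and `w` are adjacent), a designated set of marked vertices, and a number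
of free loops. -/
structure MarkedGraph (V : Type) [Fintype V] [DecidableEq V] where
  adj : Matrix V V (ZMod 2)
  marked : V → Bool
  freeLoops : ℕ

namespace MarkedGraph

variable {V : Type} [Fintype V] [DecidableEq V]

/-- GF(2)-nullity of a square matrix: the dimension of its kernel. -/
noncomputable def nullity {ι : Type*} [Fintype ι] (M : Matrix ι ι (ZMod 2)) : ℕ :=
  Module.finrank (ZMod 2) (LinearMap.ker M.mulVecLin)

/-- The diagonal matrix `Δ_T` over GF(2) whose diagonal entry at `v` is 1 iff `v ∈ T`. -/
def delta (T : Finset V) : Matrix V V (ZMod 2) :=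
  Matrix.diagonal fun v => if v ∈ T then 1 else 0

/-- The vertices kept in the submatrix `𝒜(G)_T`: delete each marked vertex whose
diagonal entry in `𝒜(G) + Δ_T` is 0. -/
def keep (G : MarkedGraph V) (T : Finset V) : Finset V :=
  Finset.univ.filter fun v => ¬ (G.marked v = true ∧ (G.adj + delta T) v v = 0)

/-- The submatrix `𝒜(G)_T` of `𝒜(G) + Δ_T`. -/
def subMat (G : MarkedGraph V) (T : Finset V) :
    Matrix (G.keep T) (G.keep T) (ZMod 2) :=
  fun i j => (G.adj + delta T) i.1 j.1

/-- The marked-graph bracket polynomial `[G] ∈ ℤ[A,B,d]`, where `A = X 0`, `B = X 1`,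
`d = X 2`:  `[G] = d^φ ⬝ Σ_{T ⊆ V(G)} A^(n-|T|) B^(|T|) d^(ν(𝒜(G)_T))`. -/
noncomputable def bracket (G : MarkedGraph V) : MvPolynomial (Fin 3) ℤ :=
  X 2 ^ G.freeLoops *
    ∑ T : Finset V,
      X 0 ^ (Fintype.card V - T.card) * X 1 ^ T.card * X 2 ^ nullity (G.subMat T)

/-- `x` is a neighbor of `v` (no vertex is a neighbor of itself). -/
def nbr (G : MarkedGraph V) (v x : V) : Prop := x ≠ v ∧ G.adj v x = 1

instance (G : MarkedGraph V) (v x : V) : Decidable (G.nbr v x) :=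
  inferInstanceAs (Decidable (x ≠ v ∧ G.adj v x = 1))

/-- Delete the vertices in `s`, together with all incident edges
(marks and free loops unchanged). -/
def delete (G : MarkedGraph V) (s : Finset V) : MarkedGraph {v : V // v ∉ s} where
  adj := fun i j => G.adj i.1 j.1
  marked := fun i => G.marked i.1
  freeLoops := G.freeLoops

/-- The local complement `G^v`: toggle every entry of the adjacency matrix (diagonal
entries included) whose row and column indices are both neighbors of `v`. -/
def localComp (G : MarkedGraph V) (v : V) : MarkedGraph V :=
  { G with adj := fun x y => if G.nbr v x ∧ G.nbr v y then G.adj x y + 1 else G.adj x y }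

/-- `G - {v,v}`: remove the loop at `v` (set the diagonal entry at `v` to 0). -/
def removeLoop (G : MarkedGraph V) (v : V) : MarkedGraph V :=
  { G with adj := fun x y => if x = v ∧ y = v then 0 else G.adj x y }

/-- `G + I`: toggle all loops. -/
def addI (G : MarkedGraph V) : MarkedGraph V :=
  { G with adj := G.adj + 1 }

/-- `G⁺`: adjoin one free loop. -/
def addFreeLoop (G : MarkedGraph V) : MarkedGraph V :=
  { G with freeLoops := G.freeLoops + 1 }

/-- The condition under which the pivot `G^{vw}` toggles the adjacency between `x`
and `y`: `x` is a neighbor of `v`, `y` is a neighbor of `w`, and either `x` is not a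
neighbor of `w` or `y` is not a neighbor of `v`. -/
def pivotCond (G : MarkedGraph V) (v w x y : V) : Prop :=
  G.nbr v x ∧ G.nbr w y ∧ (¬ G.nbr w x ∨ ¬ G.nbr v y)

instance (G : MarkedGraph V) (v w x y : V) : Decidable (G.pivotCond v w x y) :=
  inferInstanceAs (Decidable (G.nbr v x ∧ G.nbr w y ∧ (¬ G.nbr w x ∨ ¬ G.nbr v y)))

/-- The pivot `G^{vw}`: toggle the adjacency between every pair of distinct vertices
`x, y ∉ {v,w}` such that `x` is a neighbor of `v`, `y` is a neighbor of `w`, and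
either `x` is not a neighbor of `w` or `y` is not a neighbor of `v`
(loops are unaffected). -/
def pivot (G : MarkedGraph V) (v w : V) : MarkedGraph V :=
  { G with adj := fun x y =>
      if x ≠ v ∧ x ≠ w ∧ y ≠ v ∧ y ≠ w ∧ x ≠ y ∧
          (G.pivotCond v w x y ∨ G.pivotCond v w y x)
      then G.adj x y + 1 else G.adj x y }

/-- Interchange the neighbors of `v` and `w` in an adjacency matrix, keeping loops
and the edge between `v` and `w` unchanged. -/
def swapAdjacencies (M : Matrix V V (ZMod 2)) (v w : V) : Matrix V V (ZMod 2) :=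
  fun x y =>
    if x = y then M x y
    else if (x = v ∧ y = w) ∨ (x = w ∧ y = v) then M x y
    else M (Equiv.swap v w x) (Equiv.swap v w y)

/-- The marked pivot `G_c^{vw}`: the pivot `G^{vw}` with the marks on `v` and `w`
toggled and the neighbors of `v` and `w` interchanged (loops, the edge between `v`
and `w`, and free loops unchanged). -/
def markedPivot (G : MarkedGraph V) (v w : V) : MarkedGraph V where
  adj := swapAdjacencies (G.pivot v w).adj v w
  marked := fun u => if u = v ∨ u = w then !(G.marked u) else G.marked u
  freeLoops := G.freeLoops

/-- The disjoint union of two marked graphs: block-diagonal adjacency matrix,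
each vertex marked as it was, free loops added. -/
def disjUnion {V₁ V₂ : Type} [Fintype V₁] [DecidableEq V₁] [Fintype V₂] [DecidableEq V₂]
    (G₁ : MarkedGraph V₁) (G₂ : MarkedGraph V₂) : MarkedGraph (V₁ ⊕ V₂) where
  adj := Matrix.fromBlocks G₁.adj 0 0 G₂.adj
  marked := Sum.elim G₁.marked G₂.marked
  freeLoops := G₁.freeLoops + G₂.freeLoops

/-- Remove the three edges `{u,v}`, `{u,w}`, `{v,w}` (all else unchanged). -/
def removeEdges3 (G : MarkedGraph V) (u v w : V) : MarkedGraph V :=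
  { G with adj := fun x y =>
      if (x = u ∧ y = v) ∨ (x = v ∧ y = u) ∨ (x = u ∧ y = w) ∨ (x = w ∧ y = u) ∨
          (x = v ∧ y = w) ∨ (x = w ∧ y = v)
      then 0 else G.adj x y }

/-- Adjoin one isolated, unmarked vertex with no incident edges; it is looped iff
`loop = true`. -/
def addIsolated (G : MarkedGraph V) (loop : Bool) : MarkedGraph (Option V) where
  adj := fun x y =>
    match x, y with
    | some a, some b => G.adj a b
    | none, none => if loop then 1 else 0
    | _, _ => 0
  marked := fun x => match x with | some a => G.marked a | none => false
  freeLoops := G.freeLoops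

/-- The number of vertices of `s` that are adjacent to `x`. -/
def countAdj (G : MarkedGraph V) (x : V) (s : Finset V) : ℕ :=
  (s.filter fun y => G.adj x y = 1).card

/-- The reduced marked-graph bracket `⟨G⟩ ∈ ℤ[A, A⁻¹]`: substitute `B ↦ A⁻¹` and
`d ↦ -A² - A⁻²` in `[G]`. -/
noncomputable def reducedBracket (G : MarkedGraph V) : LaurentPolynomial ℤ :=
  MvPolynomial.aeval
    ![LaurentPolynomial.T 1, LaurentPolynomial.T (-1),
      -LaurentPolynomial.T 2 - LaurentPolynomial.T (-2)] G.bracket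

/-- The number of looped vertices of `G`. -/
def numLoops (G : MarkedGraph V) : ℕ :=
  (Finset.univ.filter fun v => G.adj v v = 1).card

/-- The Jones polynomial `V_G = (-1)^n ⬝ q^(3n-6ℓ) ⬝ ⟨G⟩(q⁻¹)`, as a Laurent
polynomial in the formal variable `q` (representing `t^(1/4)`); substituting
`A ↦ q⁻¹` in `⟨G⟩` amounts to substituting `A ↦ q⁻¹`, `B ↦ q`, `d ↦ -q² - q⁻²`
in `[G]`. -/
noncomputable def jones (G : MarkedGraph V) : LaurentPolynomial ℤ :=
  (-1) ^ Fintype.card V *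
    LaurentPolynomial.T (3 * (Fintype.card V : ℤ) - 6 * (G.numLoops : ℤ)) *
    MvPolynomial.aeval
      ![LaurentPolynomial.T (-1), LaurentPolynomial.T 1,
        -LaurentPolynomial.T 2 - LaurentPolynomial.T (-2)] G.bracket

end MarkedGraph
namespace MarkedGraph
open Matrix

set_option linter.all false

lemma finrank_eq_of_inv {E E' : Type*} [AddCommGroup E] [Module (ZMod 2) E] [AddCommGroup E']
    [Module (ZMod 2) E'] (S : Submodule (ZMod 2) E) (S' : Submodule (ZMod 2) E')
    (f : E →ₗ[ZMod 2] E') (g : E' →ₗ[ZMod 2] E)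
    (hf : ∀ x ∈ S, f x ∈ S') (hg : ∀ x ∈ S', g x ∈ S)
    (hgf : ∀ x ∈ S, g (f x) = x) (hfg : ∀ x ∈ S', f (g x) = x) :
    Module.finrank (ZMod 2) S = Module.finrank (ZMod 2) S' := by
  refine LinearEquiv.finrank_eq
    (LinearEquiv.ofLinearMap (f.restrict hf) (g.restrict hg) ?_ ?_)
  · ext x; exact hfg x.1 x.2
  · ext x; exact hgf x.1 x.2

lemma finrank_add_one {E : Type*} [AddCommGroup E] [Module (ZMod 2) E] [FiniteDimensional (ZMod 2) E]
    (S S' : Submodule (ZMod 2) E) (p : E →ₗ[ZMod 2] ZMod 2) (e : E) (he : e ∈ S) (hpe : p e = 1)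
    (h : ∀ x, x ∈ S' ↔ x ∈ S ∧ p x = 0) :
    Module.finrank (ZMod 2) S = Module.finrank (ZMod 2) S' + 1 := by
  let q := p.domRestrict S
  have h1 := LinearMap.finrank_range_add_finrank_ker q
  have h2 : LinearMap.range q = ⊤ := by
    rw [LinearMap.range_eq_top]
    intro c
    exact ⟨c • ⟨e, he⟩, by simp [q, hpe]⟩
  have h3 : Module.finrank (ZMod 2) (LinearMap.ker q) = Module.finrank (ZMod 2) S' := by
    rw [← Submodule.finrank_map_subtype_eq]
    have : Submodule.map S.subtype (LinearMap.ker q) = S' := by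
      ext x
      simp [q, h x, and_comm]
    rw [this]
  rw [h2, finrank_top, Module.finrank_self] at h1
  omega

variable {V : Type} [Fintype V] [DecidableEq V]

def sol (A : Matrix V V (ZMod 2)) (K T : Finset V) : Submodule (ZMod 2) (V → ZMod 2) where
  carrier := {x | (∀ i, i ∉ K → x i = 0) ∧
    ∀ i, i ∈ K → (A *ᵥ x) i + (if i ∈ T then x i else 0) = 0}
  add_mem' := by
    rintro x y ⟨h1, h2⟩ ⟨h3, h4⟩
    refine ⟨fun i hi => by simp [h1 i hi, h3 i hi], fun i hi => ?_⟩
    have := h2 i hi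
    have := h4 i hi
    simp only [mulVec_add, Pi.add_apply]
    split_ifs at * <;> grind
  zero_mem' := by simp
  smul_mem' := by
    rintro c x ⟨h1, h2⟩
    refine ⟨fun i hi => by simp [h1 i hi], fun i hi => ?_⟩
    have := h2 i hi
    simp only [mulVec_smul, Pi.smul_apply, smul_eq_mul]
    split_ifs at * <;> grind

lemma mem_sol (A : Matrix V V (ZMod 2)) (K T : Finset V) (x : V → ZMod 2) :
    x ∈ sol A K T ↔ (∀ i, i ∉ K → x i = 0) ∧
    ∀ i, i ∈ K → (A *ᵥ x) i + (if i ∈ T then x i else 0) = 0 := Iff.rfl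

lemma nullity_eq_sol {ι : Type} [Fintype ι] [DecidableEq ι] (M : Matrix ι ι (ZMod 2)) (A : Matrix V V (ZMod 2))
    (K T : Finset V) (f : ι → V) (hf : Function.Injective f) (hK : ∀ i, i ∈ K ↔ i ∈ Set.range f)
    (hM : ∀ i j, M i j = A (f i) (f j) + delta T (f i) (f j)) :
    nullity M = Module.finrank (ZMod 2) (sol A K T) := by
  have key : ∀ x : V → ZMod 2, (∀ i, i ∉ K → x i = 0) → ∀ i,
      (M *ᵥ (x ∘ f)) i = (A *ᵥ x) (f i) + (if f i ∈ T then x (f i) else 0) := by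
    intro x hx i
    have e1 : (if f i ∈ T then x (f i) else 0) = (delta T *ᵥ x) (f i) := by
      simp [delta, mulVec_diagonal]
    rw [e1, ← Pi.add_apply, ← add_mulVec]
    simp only [mulVec, dotProduct]
    refine Fintype.sum_of_injective f hf _ _ ?_ ?_
    · intro j hj
      rw [hx j (by rwa [hK]), mul_zero]
    · intro j
      simp [hM]
  have hext : ∀ y : ι → ZMod 2, (Function.extend f y 0) ∘ f = y := by
    intro y; funext i; simp [hf.extend_apply]
  have hext0 : ∀ y : ι → ZMod 2, ∀ i, i ∉ K → Function.extend f y 0 i = 0 := by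
    intro y i hi
    rw [Function.extend_apply']
    · rfl
    · intro h; exact hi ((hK i).2 h)
  refine finrank_eq_of_inv _ _ (Function.ExtendByZero.linearMap (ZMod 2) f)
    (LinearMap.funLeft (ZMod 2) (ZMod 2) f) ?_ ?_ ?_ ?_
  · intro y hy
    refine ⟨hext0 y, fun i hi => ?_⟩
    obtain ⟨j, rfl⟩ := (hK i).1 hi
    change (A *ᵥ (Function.extend f y 0)) (f j) + (if f j ∈ T then (Function.extend f y 0) (f j) else 0) = 0
    rw [← key _ (hext0 y), hext]
    exact congrFun hy j
  · rintro x ⟨h1, h2⟩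
    refine LinearMap.mem_ker.2 ?_
    funext i
    change (M *ᵥ (x ∘ f)) i = 0
    rw [key x h1]
    exact h2 _ ((hK _).2 ⟨i, rfl⟩)
  · intro y _
    exact hext y
  · rintro x ⟨h1, h2⟩
    funext i
    change Function.extend f (x ∘ f) 0 i = x i
    by_cases hi : i ∈ K
    · obtain ⟨j, rfl⟩ := (hK i).1 hi
      simp [hf.extend_apply]
    · rw [hext0 _ _ hi, h1 i hi]

/-- Add `p x` to coordinate `a` and `q x` to coordinate `b`. -/
def shear (a b : V) (p q : (V → ZMod 2) →ₗ[ZMod 2] ZMod 2) : (V → ZMod 2) →ₗ[ZMod 2] (V → ZMod 2) :=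
  LinearMap.id + (LinearMap.single (ZMod 2) (fun _ => ZMod 2) a).comp p
    + (LinearMap.single (ZMod 2) (fun _ => ZMod 2) b).comp q

lemma shear_apply (a b : V) (p q : (V → ZMod 2) →ₗ[ZMod 2] ZMod 2) (x : V → ZMod 2) (i : V) :
    shear a b p q x i = x i + (if i = a then p x else 0) + (if i = b then q x else 0) := by
  simp [shear, Pi.single_apply]

lemma mulVec_shear (A : Matrix V V (ZMod 2)) (a b : V) (p q : (V → ZMod 2) →ₗ[ZMod 2] ZMod 2)
    (x : V → ZMod 2) (i : V) :
    (A *ᵥ shear a b p q x) i = (A *ᵥ x) i + A i a * p x + A i b * q x := by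
  simp [shear, mulVec_add, mul_comm]

/-- Row functional. -/
def rowf (A : Matrix V V (ZMod 2)) (i : V) : (V → ZMod 2) →ₗ[ZMod 2] ZMod 2 :=
  (LinearMap.proj i).comp A.mulVecLin

lemma rowf_apply (A : Matrix V V (ZMod 2)) (i : V) (x : V → ZMod 2) : rowf A i x = (A *ᵥ x) i := rfl

set_option maxHeartbeats 2000000 in
lemma sol_pivot (A A' : Matrix V V (ZMod 2)) (v w z : V) (K K' T : Finset V)
    (hvw : v ≠ w) (hzv : z ≠ v) (hzw : z ≠ w) (hs : ∀ i j, A i j = A j i)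
    (hwz : A w z = 1) (hww : A w w = 0) (hvK : v ∉ K) (hwK : w ∉ K) (hvT : v ∉ T) (hwT : w ∉ T)
    (hE1 : ∀ u : V → ZMod 2, u v = 0 → u w = 0 → ∀ i, i ≠ v → i ≠ w → i ≠ z →
      (A' *ᵥ u) i = (A *ᵥ u) i + A w i * (A *ᵥ u) z + A z i * (A *ᵥ u) w
        + A w i * (1 + A z z) * u z)
    (hE2 : ∀ u : V → ZMod 2, u v = 0 → u w = 0 →
      (A' *ᵥ u) z = (A *ᵥ u) w + (1 + A z z) * u z)
    (hKK : ∀ i, i ≠ z → (i ∈ K' ↔ i ∈ K))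
    (hc : (A z z + (if z ∈ T then 1 else 0) = 1 ∧ z ∈ K ∧ z ∈ K') ∨
      (A z z + (if z ∈ T then 1 else 0) = 0 ∧ z ∈ K ∧ z ∉ K') ∨
      (A z z + (if z ∈ T then 1 else 0) = 0 ∧ z ∉ K ∧ z ∈ K')) :
    Module.finrank (ZMod 2) (sol A (insert w K) T) = Module.finrank (ZMod 2) (sol A' K' T) := by
  have hzw' : A z w = 1 := by rw [hs, hwz]
  have hvK' : v ∉ K' := by rwa [hKK v hzv.symm]
  have hwK' : w ∉ K' := by rwa [hKK w hzw.symm]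
  have hKi : ∀ i, i ∈ K → i ≠ v ∧ i ≠ w := fun i hi =>
    ⟨fun h => hvK (h ▸ hi), fun h => hwK (h ▸ hi)⟩
  have hKi' : ∀ i, i ∈ K' → i ≠ v ∧ i ≠ w := fun i hi =>
    ⟨fun h => hvK' (h ▸ hi), fun h => hwK' (h ▸ hi)⟩
  let pr : V → (V → ZMod 2) →ₗ[ZMod 2] ZMod 2 := fun i => LinearMap.proj i
  have hpr : ∀ i x, pr i x = x i := fun i x => rfl
  rcases hc with ⟨hc, hzK, hzK'⟩ | ⟨hc, hzK, hzK'⟩ | ⟨hc, hzK, hzK'⟩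
  · refine finrank_eq_of_inv _ _ (shear w w (pr w) 0)
      (shear w w (rowf A z + (if z ∈ T then 1 else 0 : ZMod 2) • pr z) 0) ?_ ?_ ?_ ?_
    · rintro x ⟨h1, h2⟩
      have hxv : x v = 0 := h1 v (by simp [hvK, hvw])
      have hw2 := h2 w (by simp)
      have hz2 := h2 z (by simp [hzK])
      have fv : (shear w w (pr w) 0) x v = 0 := by simp [shear_apply, hvw, hzv.symm, hxv]
      have fw : (shear w w (pr w) 0) x w = 0 := by
        simp [shear_apply, hpr, hzw.symm]
        try grind
      refine ⟨fun i hi => ?_, fun i hi => ?_⟩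
      · by_cases hiw : i = w
        · rw [hiw, fw]
        · by_cases hiz : i = z
          · subst hiz
            first
            | exact absurd hzK' hi
            | (simp [shear_apply, hzw, hpr, rowf_apply]; try grind)
          · have : i ∉ K := by rwa [← hKK i hiz]
            simp [shear_apply, hiw, hiz, h1 i (by simp [hiw, this])]
      · by_cases hiz : i = z
        · subst hiz
          rw [hE2 _ fv fw]
          simp only [mulVec_shear, shear_apply, hpr, rowf_apply, hzw, if_false, if_true,
            LinearMap.zero_apply]
          split_ifs at * <;> grind
        · have hiK := (hKK i hiz).1 hi
          have hi2 := h2 i (by simp [hiK])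
          have := hKi i hiK
          rw [hE1 _ fv fw i this.1 this.2 hiz]
          simp only [mulVec_shear, shear_apply, hpr, rowf_apply, hzw, this, hiz, if_false, if_true,
            LinearMap.zero_apply]
          have := hs i w
          have := hs i z
          split_ifs at * <;> grind
    · rintro u ⟨h1, h2⟩
      have huv : u v = 0 := h1 v hvK'
      have huw : u w = 0 := h1 w hwK'
      have hz2 := h2 z hzK'
      have e2 := hE2 u huv huw
      refine ⟨fun i hi => ?_, fun i hi => ?_⟩
      · have hiw : i ≠ w := fun h => hi (by simp [h])
        have hiK : i ∉ K := fun h => hi (by simp [h])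
        by_cases hiz : i = z
        · subst hiz
          first
          | exact absurd hzK hiK
          | (simp [shear_apply, hzw, hpr, rowf_apply]; try grind)
        · simp [shear_apply, hiw, hiz, h1 i (by rwa [hKK i hiz])]
      · by_cases hiw : i = w
        · subst hiw
          simp only [mulVec_shear, shear_apply, hpr, rowf_apply, hzw, hzw.symm, if_false, if_true,
            LinearMap.zero_apply, LinearMap.add_apply, LinearMap.smul_apply, smul_eq_mul, hwT]
          split_ifs at * <;> grind
        have hiK : i ∈ K := by simpa [hiw] using hi
        by_cases hiz : i = z
        · subst hiz
          simp only [mulVec_shear, shear_apply, hpr, rowf_apply, hzw, hzw.symm, if_false, if_true,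
            LinearMap.zero_apply, LinearMap.add_apply, LinearMap.smul_apply, smul_eq_mul]
          split_ifs at * <;> grind
        · have hi2 := h2 i ((hKK i hiz).2 hiK)
          have e1 := hE1 u huv huw i (hKi i hiK).1 hiw hiz
          simp only [mulVec_shear, shear_apply, hpr, rowf_apply, hiw, hiz, if_false, if_true,
            LinearMap.zero_apply, LinearMap.add_apply, LinearMap.smul_apply, smul_eq_mul]
          have := hs i w
          have := hs i z
          split_ifs at * <;> grind
    · rintro x ⟨h1, h2⟩
      have hxv : x v = 0 := h1 v (by simp [hvK, hvw])
      have hw2 := h2 w (by simp)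
      have hz2 := h2 z (by simp [hzK])
      funext i
      simp only [mulVec_shear, shear_apply, hpr, rowf_apply, hzw, hzw.symm, if_false, if_true,
            LinearMap.zero_apply, LinearMap.add_apply, LinearMap.smul_apply, smul_eq_mul]
      split_ifs at * <;> grind
    · rintro u ⟨h1, h2⟩
      have huv : u v = 0 := h1 v hvK'
      have huw : u w = 0 := h1 w hwK'
      have hz2 := h2 z hzK'
      have e2 := hE2 u huv huw
      funext i
      simp only [mulVec_shear, shear_apply, hpr, rowf_apply, hzw, hzw.symm, if_false, if_true,
            LinearMap.zero_apply, LinearMap.add_apply, LinearMap.smul_apply, smul_eq_mul]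
      split_ifs at * <;> grind
  · refine finrank_eq_of_inv _ _ (shear w z (pr w) (pr z))
      (shear w z (rowf A z) (rowf A w)) ?_ ?_ ?_ ?_
    · rintro x ⟨h1, h2⟩
      have hxv : x v = 0 := h1 v (by simp [hvK, hvw])
      have hw2 := h2 w (by simp)
      have hz2 := h2 z (by simp [hzK])
      have fv : (shear w z (pr w) (pr z)) x v = 0 := by simp [shear_apply, hvw, hzv.symm, hxv]
      have fw : (shear w z (pr w) (pr z)) x w = 0 := by
        simp [shear_apply, hpr, hzw.symm]
        try grind
      refine ⟨fun i hi => ?_, fun i hi => ?_⟩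
      · by_cases hiw : i = w
        · rw [hiw, fw]
        · by_cases hiz : i = z
          · subst hiz
            first
            | exact absurd hzK' hi
            | (simp [shear_apply, hzw, hpr, rowf_apply]; try grind)
          · have : i ∉ K := by rwa [← hKK i hiz]
            simp [shear_apply, hiw, hiz, h1 i (by simp [hiw, this])]
      · by_cases hiz : i = z
        · subst hiz
          rw [hE2 _ fv fw]
          simp only [mulVec_shear, shear_apply, hpr, rowf_apply, hzw, if_false, if_true,
            LinearMap.zero_apply]
          split_ifs at * <;> grind
        · have hiK := (hKK i hiz).1 hi
          have hi2 := h2 i (by simp [hiK])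
          have := hKi i hiK
          rw [hE1 _ fv fw i this.1 this.2 hiz]
          simp only [mulVec_shear, shear_apply, hpr, rowf_apply, hzw, this, hiz, if_false, if_true,
            LinearMap.zero_apply]
          have := hs i w
          have := hs i z
          split_ifs at * <;> grind
    · rintro u ⟨h1, h2⟩
      have huv : u v = 0 := h1 v hvK'
      have huw : u w = 0 := h1 w hwK'
      have hz2 := h1 z hzK'
      have e2 := hE2 u huv huw
      refine ⟨fun i hi => ?_, fun i hi => ?_⟩
      · have hiw : i ≠ w := fun h => hi (by simp [h])
        have hiK : i ∉ K := fun h => hi (by simp [h])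
        by_cases hiz : i = z
        · subst hiz
          first
          | exact absurd hzK hiK
          | (simp [shear_apply, hzw, hpr, rowf_apply]; try grind)
        · simp [shear_apply, hiw, hiz, h1 i (by rwa [hKK i hiz])]
      · by_cases hiw : i = w
        · subst hiw
          simp only [mulVec_shear, shear_apply, hpr, rowf_apply, hzw, hzw.symm, if_false, if_true,
            LinearMap.zero_apply, LinearMap.add_apply, LinearMap.smul_apply, smul_eq_mul, hwT]
          split_ifs at * <;> grind
        have hiK : i ∈ K := by simpa [hiw] using hi
        by_cases hiz : i = z
        · subst hiz
          simp only [mulVec_shear, shear_apply, hpr, rowf_apply, hzw, hzw.symm, if_false, if_true,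
            LinearMap.zero_apply, LinearMap.add_apply, LinearMap.smul_apply, smul_eq_mul]
          split_ifs at * <;> grind
        · have hi2 := h2 i ((hKK i hiz).2 hiK)
          have e1 := hE1 u huv huw i (hKi i hiK).1 hiw hiz
          simp only [mulVec_shear, shear_apply, hpr, rowf_apply, hiw, hiz, if_false, if_true,
            LinearMap.zero_apply, LinearMap.add_apply, LinearMap.smul_apply, smul_eq_mul]
          have := hs i w
          have := hs i z
          split_ifs at * <;> grind
    · rintro x ⟨h1, h2⟩
      have hxv : x v = 0 := h1 v (by simp [hvK, hvw])
      have hw2 := h2 w (by simp)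
      have hz2 := h2 z (by simp [hzK])
      funext i
      simp only [mulVec_shear, shear_apply, hpr, rowf_apply, hzw, hzw.symm, if_false, if_true,
            LinearMap.zero_apply, LinearMap.add_apply, LinearMap.smul_apply, smul_eq_mul]
      split_ifs at * <;> grind
    · rintro u ⟨h1, h2⟩
      have huv : u v = 0 := h1 v hvK'
      have huw : u w = 0 := h1 w hwK'
      have hz2 := h1 z hzK'
      have e2 := hE2 u huv huw
      funext i
      simp only [mulVec_shear, shear_apply, hpr, rowf_apply, hzw, hzw.symm, if_false, if_true,
            LinearMap.zero_apply, LinearMap.add_apply, LinearMap.smul_apply, smul_eq_mul]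
      split_ifs at * <;> grind
  · refine finrank_eq_of_inv _ _ (shear w z (pr w) (rowf A z))
      (shear w z (rowf A z + (if z ∈ T then 1 else 0 : ZMod 2) • pr z + pr z) (pr z)) ?_ ?_ ?_ ?_
    · rintro x ⟨h1, h2⟩
      have hxv : x v = 0 := h1 v (by simp [hvK, hvw])
      have hw2 := h2 w (by simp)
      have hz2 := h1 z (by simp [hzK, hzw])
      have fv : (shear w z (pr w) (rowf A z)) x v = 0 := by simp [shear_apply, hvw, hzv.symm, hxv]
      have fw : (shear w z (pr w) (rowf A z)) x w = 0 := by
        simp [shear_apply, hpr, hzw.symm]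
        try grind
      refine ⟨fun i hi => ?_, fun i hi => ?_⟩
      · by_cases hiw : i = w
        · rw [hiw, fw]
        · by_cases hiz : i = z
          · subst hiz
            first
            | exact absurd hzK' hi
            | (simp [shear_apply, hzw, hpr, rowf_apply]; try grind)
          · have : i ∉ K := by rwa [← hKK i hiz]
            simp [shear_apply, hiw, hiz, h1 i (by simp [hiw, this])]
      · by_cases hiz : i = z
        · subst hiz
          rw [hE2 _ fv fw]
          simp only [mulVec_shear, shear_apply, hpr, rowf_apply, hzw, if_false, if_true,
            LinearMap.zero_apply]
          split_ifs at * <;> grind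
        · have hiK := (hKK i hiz).1 hi
          have hi2 := h2 i (by simp [hiK])
          have := hKi i hiK
          rw [hE1 _ fv fw i this.1 this.2 hiz]
          simp only [mulVec_shear, shear_apply, hpr, rowf_apply, hzw, this, hiz, if_false, if_true,
            LinearMap.zero_apply]
          have := hs i w
          have := hs i z
          split_ifs at * <;> grind
    · rintro u ⟨h1, h2⟩
      have huv : u v = 0 := h1 v hvK'
      have huw : u w = 0 := h1 w hwK'
      have hz2 := h2 z hzK'
      have e2 := hE2 u huv huw
      refine ⟨fun i hi => ?_, fun i hi => ?_⟩
      · have hiw : i ≠ w := fun h => hi (by simp [h])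
        have hiK : i ∉ K := fun h => hi (by simp [h])
        by_cases hiz : i = z
        · subst hiz
          first
          | exact absurd hzK hiK
          | (simp [shear_apply, hzw, hpr, rowf_apply]; try grind)
        · simp [shear_apply, hiw, hiz, h1 i (by rwa [hKK i hiz])]
      · by_cases hiw : i = w
        · subst hiw
          simp only [mulVec_shear, shear_apply, hpr, rowf_apply, hzw, hzw.symm, if_false, if_true,
            LinearMap.zero_apply, LinearMap.add_apply, LinearMap.smul_apply, smul_eq_mul, hwT]
          split_ifs at * <;> grind
        have hiK : i ∈ K := by simpa [hiw] using hi
        by_cases hiz : i = z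
        · subst hiz
          simp only [mulVec_shear, shear_apply, hpr, rowf_apply, hzw, hzw.symm, if_false, if_true,
            LinearMap.zero_apply, LinearMap.add_apply, LinearMap.smul_apply, smul_eq_mul]
          split_ifs at * <;> grind
        · have hi2 := h2 i ((hKK i hiz).2 hiK)
          have e1 := hE1 u huv huw i (hKi i hiK).1 hiw hiz
          simp only [mulVec_shear, shear_apply, hpr, rowf_apply, hiw, hiz, if_false, if_true,
            LinearMap.zero_apply, LinearMap.add_apply, LinearMap.smul_apply, smul_eq_mul]
          have := hs i w
          have := hs i z
          split_ifs at * <;> grind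
    · rintro x ⟨h1, h2⟩
      have hxv : x v = 0 := h1 v (by simp [hvK, hvw])
      have hw2 := h2 w (by simp)
      have hz2 := h1 z (by simp [hzK, hzw])
      funext i
      simp only [mulVec_shear, shear_apply, hpr, rowf_apply, hzw, hzw.symm, if_false, if_true,
            LinearMap.zero_apply, LinearMap.add_apply, LinearMap.smul_apply, smul_eq_mul]
      split_ifs at * <;> grind
    · rintro u ⟨h1, h2⟩
      have huv : u v = 0 := h1 v hvK'
      have huw : u w = 0 := h1 w hwK'
      have hz2 := h2 z hzK'
      have e2 := hE2 u huv huw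
      funext i
      simp only [mulVec_shear, shear_apply, hpr, rowf_apply, hzw, hzw.symm, if_false, if_true,
            LinearMap.zero_apply, LinearMap.add_apply, LinearMap.smul_apply, smul_eq_mul]
      split_ifs at * <;> grind

lemma sol_00 (A : Matrix V V (ZMod 2)) (v w : V) (K T : Finset V) (hvw : v ≠ w)
    (hs : ∀ i j, A i j = A j i) (hvK : v ∉ K) (hwK : w ∉ K) (hvT : v ∉ T) (hwT : w ∉ T)
    (hrow : ∀ x : V → ZMod 2, (A *ᵥ x) v = (A *ᵥ x) w + x w)
    (hsame : ∀ i, i ≠ v → i ≠ w → A v i = A w i)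
    (hww : A w w = 0) (hwv : A w v = 1) (hvv : A v v = 1) (hvw' : A v w = 1) :
    Module.finrank (ZMod 2) (sol A (insert v (insert w K)) T)
      = Module.finrank (ZMod 2) (sol A (insert w K) (insert v (insert w T))) := by
  let pr : V → (V → ZMod 2) →ₗ[ZMod 2] ZMod 2 := fun i => LinearMap.proj i
  have hpr : ∀ i x, pr i x = x i := fun i x => rfl
  have hKi : ∀ i, i ∈ K → i ≠ v ∧ i ≠ w := fun i hi =>
    ⟨fun h => hvK (h ▸ hi), fun h => hwK (h ▸ hi)⟩
  have hinv : ∀ x, shear v w (pr v + pr w) (pr v + pr w)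
      (shear v w (pr v + pr w) (pr v + pr w) x) = x := by
    intro x
    funext i
    simp only [shear_apply, hpr, LinearMap.add_apply, hvw, hvw.symm, if_false, if_true]
    split_ifs <;> grind
  refine finrank_eq_of_inv _ _ (shear v w (pr v + pr w) (pr v + pr w))
    (shear v w (pr v + pr w) (pr v + pr w)) ?_ ?_ (fun x _ => hinv x) (fun x _ => hinv x)
  · rintro x ⟨h1, h2⟩
    have hv2 := h2 v (by simp)
    have hw2 := h2 w (by simp)
    have := hrow x
    simp only [hvT, hwT, if_false] at hv2 hw2
    refine ⟨fun i hi => ?_, fun i hi => ?_⟩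
    · have hiw : i ≠ w := fun h => hi (by simp [h])
      by_cases hiv : i = v
      · subst hiv
        simp only [shear_apply, hpr, LinearMap.add_apply, hvw, if_false, if_true]
        grind
      · simp [shear_apply, hiw, hiv, h1 i (by simpa [hiv] using hi)]
    · by_cases hiw : i = w
      · subst hiw
        simp only [shear_apply, mulVec_shear, hpr, LinearMap.add_apply, hvw.symm, if_false, if_true,
          Finset.mem_insert, true_or, or_true]
        grind
      · have hiK : i ∈ K := by simpa [hiw] using hi
        have hiv := (hKi i hiK).1
        have h3 := h2 i (by simp [hiK])
        have := hsame i hiv hiw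
        have := hs i v
        have := hs i w
        simp only [shear_apply, mulVec_shear, hpr, LinearMap.add_apply, hiv, hiw, if_false, if_true,
          Finset.mem_insert, false_or]
        split_ifs at * <;> grind
  · rintro x ⟨h1, h2⟩
    have hv2 := h1 v (by simp [hvw, hvK])
    have hw2 := h2 w (by simp)
    have := hrow x
    simp only [Finset.mem_insert, true_or, or_true, if_true] at hw2
    refine ⟨fun i hi => ?_, fun i hi => ?_⟩
    · have hiw : i ≠ w := fun h => hi (by simp [h])
      have hiv : i ≠ v := fun h => hi (by simp [h])
      have hiK : i ∉ K := fun h => hi (by simp [h])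
      simp [shear_apply, hiw, hiv, h1 i (by simp [hiK, hiw])]
    · by_cases hiw : i = w
      · subst hiw
        simp only [shear_apply, mulVec_shear, hpr, LinearMap.add_apply, hvw.symm, if_false, if_true,
          hwT]
        grind
      by_cases hiv : i = v
      · subst hiv
        simp only [shear_apply, mulVec_shear, hpr, LinearMap.add_apply, hvw, if_false, if_true,
          hvT]
        grind
      · have hiK : i ∈ K := by simpa [hiw, hiv] using hi
        have h3 := h2 i (by simp [hiK])
        have := hsame i hiv hiw
        have := hs i v
        have := hs i w
        simp only [Finset.mem_insert, hiv, hiw, false_or] at h3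
        simp only [shear_apply, mulVec_shear, hpr, LinearMap.add_apply, hiv, hiw, if_false, if_true]
        split_ifs at * <;> grind

lemma sol_01 (A : Matrix V V (ZMod 2)) (v w : V) (K T : Finset V) (hvw : v ≠ w)
    (hs : ∀ i j, A i j = A j i) (hvK : v ∉ K) (hwK : w ∉ K) (hvT : v ∉ T) (hwT : w ∉ T)
    (hrow : ∀ x : V → ZMod 2, (A *ᵥ x) v = (A *ᵥ x) w + x w)
    (hsame : ∀ i, i ≠ v → i ≠ w → A v i = A w i)
    (hww : A w w = 0) (hwv : A w v = 1) (hvv : A v v = 1) (hvw' : A v w = 1) :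
    Module.finrank (ZMod 2) (sol A (insert v (insert w K)) (insert w T))
      = Module.finrank (ZMod 2) (sol A (insert w K) (insert v (insert w T))) + 1 := by
  have hKi : ∀ i, i ∈ K → i ≠ v ∧ i ≠ w := fun i hi =>
    ⟨fun h => hvK (h ▸ hi), fun h => hwK (h ▸ hi)⟩
  refine finrank_add_one _ _ (LinearMap.proj v) (Pi.single v 1 + Pi.single w 1) ?_ ?_ ?_
  · refine ⟨fun i hi => ?_, fun i hi => ?_⟩
    · have hiw : i ≠ w := fun h => hi (by simp [h])
      have hiv : i ≠ v := fun h => hi (by simp [h])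
      simp [Pi.single_apply, hiw, hiv]
    · by_cases hiw : i = w
      · subst hiw
        simp [mulVec_add, Pi.single_apply, hvw.symm, hww, hwv]
        rfl
      by_cases hiv : i = v
      · subst hiv
        simp [mulVec_add, Pi.single_apply, hvw, hvv, hvw', hvT]
        rfl
      · have := hsame i hiv hiw
        have := hs i v
        have := hs i w
        simp [mulVec_add, Pi.single_apply, hiv, hiw]
        grind
  · simp [Pi.single_apply, hvw]
  · intro x
    have hr := hrow x
    simp only [mem_sol, LinearMap.proj_apply]
    constructor
    · rintro ⟨h1, h2⟩
      have hv2 := h1 v (by simp [hvw, hvK])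
      have hw2 := h2 w (by simp)
      refine ⟨⟨fun i hi => h1 i (by simp at hi ⊢; tauto), fun i hi => ?_⟩, hv2⟩
      by_cases hiv : i = v
      · subst hiv
        simp [hvw, hvT] at hw2 ⊢
        grind
      · have := h2 i (by simpa [hiv] using hi)
        simpa [hiv] using this
    · rintro ⟨⟨h1, h2⟩, hv2⟩
      refine ⟨fun i hi => ?_, fun i hi => ?_⟩
      · by_cases hiv : i = v
        · rw [hiv, hv2]
        · exact h1 i (by simp at hi ⊢; tauto)
      · have hiv : i ≠ v := by
          rintro rfl
          simp [hvw, hvK] at hi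
        have := h2 i (Finset.mem_insert_of_mem hi)
        simpa [hiv] using this

lemma sol_10 (A : Matrix V V (ZMod 2)) (v w : V) (K T : Finset V) (hvw : v ≠ w) (hvK : v ∉ K) :
    sol A (insert w K) (insert v T) = sol A (insert w K) T := by
  ext x
  simp only [mem_sol]
  refine and_congr_right fun h1 => forall_congr' fun i => forall_congr' fun hi => ?_
  have hiv : i ≠ v := by
    rintro rfl
    simp [hvw, hvK] at hi
  simp [hiv]

lemma sol_iso (A : Matrix V V (ZMod 2)) (v w : V) (K T : Finset V) (hvw : v ≠ w)
    (hs : ∀ i j, A i j = A j i) (hvK : v ∉ K) (hwK : w ∉ K) (hvT : v ∉ T) (hwT : w ∉ T)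
    (hz : ∀ i, i ≠ v → A w i = 0) :
    Module.finrank (ZMod 2) (sol A (insert w K) T) = Module.finrank (ZMod 2) (sol A K T) + 1 := by
  refine finrank_add_one _ _ (LinearMap.proj w) (Pi.single w 1) ?_ (by simp) ?_
  · refine ⟨fun i hi => ?_, fun i hi => ?_⟩
    · have hiw : i ≠ w := fun h => hi (by simp [h])
      simp [Pi.single_apply, hiw]
    · have hiv : i ≠ v := by
        rintro rfl
        simp [hvw, hvK] at hi
      by_cases hiw : i = w
      · subst hiw
        simp [hz _ hiv, hwT]
      · simp [hs i w, hz _ hiv, Pi.single_apply, hiw]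
  · intro x
    simp only [mem_sol, LinearMap.proj_apply]
    constructor
    · rintro ⟨h1, h2⟩
      refine ⟨⟨fun i hi => h1 i (by simp at hi ⊢; tauto), fun i hi => ?_⟩, h1 w hwK⟩
      rcases Finset.mem_insert.1 hi with rfl | hi
      · rw [if_neg hwT, add_zero]
        simp only [mulVec, dotProduct]
        refine Finset.sum_eq_zero fun j _ => ?_
        by_cases hj : j = v
        · rw [hj, h1 v hvK, mul_zero]
        · rw [hz j hj, zero_mul]
      · exact h2 i hi
    · rintro ⟨⟨h1, h2⟩, hw⟩
      refine ⟨fun i hi => ?_, fun i hi => h2 i (by simp [hi])⟩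
      by_cases hiw : i = w
      · rw [hiw, hw]
      · exact h1 i (by simp [hi, hiw])

lemma mem_keep (G : MarkedGraph V) (T : Finset V) (i : V) :
    i ∈ G.keep T ↔ ¬ (G.marked i = true ∧ G.adj i i + (if i ∈ T then 1 else 0) = 0) := by
  simp [keep, delta]

lemma nullity_subMat (G : MarkedGraph V) (T : Finset V) :
    nullity (G.subMat T) = Module.finrank (ZMod 2) (sol G.adj (G.keep T) T) :=
  nullity_eq_sol _ _ _ _ Subtype.val Subtype.val_injective (fun i => by simp)
    (fun i j => rfl)

/-- The underlying set in `V`. -/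
def up (s : Finset V) (t : Finset {x : V // x ∉ s}) : Finset V :=
  t.map (Function.Embedding.subtype _)

lemma mem_up (s : Finset V) (t : Finset {x : V // x ∉ s}) (i : V) (hi : i ∉ s) :
    i ∈ up s t ↔ ⟨i, hi⟩ ∈ t := by
  simp [up, hi]

lemma not_mem_up (s : Finset V) (t : Finset {x : V // x ∉ s}) (i : V) (hi : i ∈ s) :
    i ∉ up s t := by
  simp [up, hi]

lemma nullity_delete (G : MarkedGraph V) (s : Finset V) (t : Finset {x : V // x ∉ s}) :
    nullity ((G.delete s).subMat t) =
      Module.finrank (ZMod 2) (sol G.adj ((G.keep (up s t)).filter (· ∉ s)) (up s t)) := by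
  have hd : ∀ i j : {x : V // x ∉ s}, delta t i j = delta (up s t) i.1 j.1 := by
    intro i j
    simp only [delta, diagonal_apply, mem_up s t i.1 i.2, Subtype.ext_iff]
  refine nullity_eq_sol _ _ _ _ (fun i => i.1.1)
    (Subtype.val_injective.comp Subtype.val_injective) ?_ ?_
  · intro i
    by_cases hi : i ∈ s
    · refine iff_of_false (fun h => (Finset.mem_filter.1 h).2 hi) ?_
      rintro ⟨a, rfl⟩
      exact a.1.2 hi
    · have : i ∈ G.keep (up s t) ↔ (⟨i, hi⟩ : {x : V // x ∉ s}) ∈ (G.delete s).keep t := by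
        rw [mem_keep, mem_keep]
        simp only [mem_up s t i hi, delete]
      simp only [Finset.mem_filter, this, hi, not_false_iff, and_true, Set.mem_range]
      constructor
      · intro h; exact ⟨⟨⟨i, hi⟩, h⟩, rfl⟩
      · rintro ⟨a, rfl⟩; exact a.2
  · intro i j
    rw [← hd]
    rfl

lemma reducedBracket_eq (G : MarkedGraph V) (a b d : LaurentPolynomial ℤ)
    (ha : a = LaurentPolynomial.T 1) (hb : b = LaurentPolynomial.T (-1))
    (hd : d = -LaurentPolynomial.T 2 - LaurentPolynomial.T (-2)) :
    G.reducedBracket = d ^ G.freeLoops * ∑ T : Finset V,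
      a ^ (Fintype.card V - T.card) * b ^ T.card * d ^ nullity (G.subMat T) := by
  subst ha hb hd
  unfold reducedBracket bracket
  simp only [map_mul, map_pow, map_sum, aeval_X]
  rfl

lemma sum_split {R : Type*} [AddCommMonoid R] (v w : V) (hvw : v ≠ w) (F : Finset V → R) :
    ∑ T : Finset V, F T = ∑ t : Finset {x : V // x ∉ ({v, w} : Finset V)},
      ((F (up _ t) + F (insert w (up _ t))) +
        (F (insert v (up _ t)) + F (insert v (insert w (up _ t))))) := by
  have hR : (Finset.univ : Finset V) = insert v (insert w (Finset.univ.filter (· ∉ ({v, w} : Finset V)))) := by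
    ext i
    simp
    tauto
  rw [← Finset.powerset_univ, hR, Finset.sum_powerset_insert (by simp [hvw]),
    Finset.sum_powerset_insert (by simp), Finset.sum_powerset_insert (by simp),
    ← Finset.sum_add_distrib, ← Finset.sum_add_distrib, ← Finset.sum_add_distrib]
  symm
  refine Finset.sum_nbij' (fun t => up _ t) (fun T => T.subtype _) ?_ ?_ ?_ ?_ ?_
  · intro t _
    rw [Finset.mem_powerset]
    intro i hi
    by_contra h
    exact not_mem_up _ t i (by simp at h ⊢; tauto) hi
  · intro T _; exact Finset.mem_univ _
  · intro t _
    ext i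
    simp [mem_up _ t i.1 i.2]
  · intro T hT
    rw [Finset.mem_powerset] at hT
    ext i
    by_cases hi : i ∈ ({v, w} : Finset V)
    · exact iff_of_false (not_mem_up _ _ i hi) (fun h => (Finset.mem_filter.1 (hT h)).2 hi)
    · simp [mem_up _ _ i hi]
  · intro t _; rfl

lemma reducedBracket_main (G : MarkedGraph V) (hsym : G.adj.IsSymm) (v w : V) (hvw : v ≠ w)
    (hadj : G.adj v w = 1)
    (hv : G.adj v v = 1) (hmv : G.marked v = true)
    (hw : G.adj w w = 0) (hmw : G.marked w = false)
    (hsame : ∀ x, x ≠ v → x ≠ w → G.adj v x = G.adj w x)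
    (a b d : LaurentPolynomial ℤ)
    (ha : a = LaurentPolynomial.T 1) (hb : b = LaurentPolynomial.T (-1))
    (hd : d = -LaurentPolynomial.T 2 - LaurentPolynomial.T (-2)) :
    G.reducedBracket = d ^ G.freeLoops * ∑ t : Finset {x : V // x ∉ ({v, w} : Finset V)},
      a ^ (Fintype.card {x : V // x ∉ ({v, w} : Finset V)} - t.card) * b ^ t.card *
        d ^ Module.finrank (ZMod 2) (sol G.adj
          (insert w ((G.keep (up _ t)).filter (· ∉ ({v, w} : Finset V)))) (up _ t)) := by
  rw [reducedBracket_eq G a b d ha hb hd, sum_split v w hvw]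
  congr 1
  refine Finset.sum_congr rfl fun t _ => ?_
  have hab : a * b = 1 := by
    rw [ha, hb, ← LaurentPolynomial.T_add]; simp
  have hd' : d = -a ^ 2 - b ^ 2 := by
    rw [ha, hb, hd, LaurentPolynomial.T_pow, LaurentPolynomial.T_pow]; norm_num
  have hs : ∀ i j, G.adj i j = G.adj j i := fun i j => hsym.apply j i
  have hwv : G.adj w v = 1 := by rw [hs, hadj]
  have hrow : ∀ x : V → ZMod 2, (G.adj *ᵥ x) v = (G.adj *ᵥ x) w + x w := by
    intro x
    have : x w = ∑ j, (if j = w then 1 else 0) * x j := by simp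
    rw [this]
    simp only [mulVec, dotProduct]
    rw [← Finset.sum_add_distrib]
    refine Finset.sum_congr rfl fun j _ => ?_
    rw [← add_mul]
    congr 1
    by_cases hjw : j = w
    · simp [hjw, hadj, hw]
    by_cases hjv : j = v
    · simp [hjv, hv, hwv, hvw]
    simp [hjw, hsame j hjv hjw]
  set T := up _ t with hT
  set K := (G.keep T).filter (· ∉ ({v, w} : Finset V)) with hK
  have hvT : v ∉ T := not_mem_up _ t v (by simp)
  have hwT : w ∉ T := not_mem_up _ t w (by simp)
  have hvK : v ∉ K := by simp [hK]
  have hwK : w ∉ K := by simp [hK]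
  have hcard : T.card = t.card := by simp [hT, up]
  have hcV : Fintype.card V = Fintype.card {x : V // x ∉ ({v, w} : Finset V)} + 2 := by
    have := Fintype.card_subtype_compl (fun x : V => x ∈ ({v, w} : Finset V))
    have h2 : Fintype.card {x : V // x ∈ ({v, w} : Finset V)} = 2 := by
      rw [Fintype.card_coe, Finset.card_pair hvw]
    have h3 := Fintype.card_subtype_le (fun x : V => x ∈ ({v, w} : Finset V))
    omega
  have hle : t.card ≤ Fintype.card {x : V // x ∉ ({v, w} : Finset V)} := Finset.card_le_univ t
  have hnot : ∀ i, i ≠ v → i ≠ w → ∀ T', (i ∈ T' ↔ i ∈ T) → (i ∈ G.keep T' ↔ i ∈ K) := by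
    intro i hiv hiw T' h
    simp [hK, keep, delta, hiv, hiw, h]
  have k00 : G.keep T = insert v (insert w K) := by
    ext i
    by_cases hiv : i = v
    · subst hiv; simp [keep, delta, hv, hvT]
    by_cases hiw : i = w
    · subst hiw; simp [keep, hmw]
    simp [hiv, hiw, hnot i hiv hiw T]
  have k01 : G.keep (insert w T) = insert v (insert w K) := by
    ext i
    by_cases hiv : i = v
    · subst hiv; simp [keep, delta, hv, hvT, hvw]
    by_cases hiw : i = w
    · subst hiw; simp [keep, hmw]
    simp [hiv, hiw, hnot i hiv hiw (insert w T)]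
  have h11 : (1 : ZMod 2) + 1 = 0 := rfl
  have k10 : G.keep (insert v T) = insert w K := by
    ext i
    by_cases hiv : i = v
    · subst hiv; simp [keep, delta, hv, hvw, hvK, hmv, h11]
    by_cases hiw : i = w
    · subst hiw; simp [keep, hmw]
    simp [hiv, hiw, hnot i hiv hiw (insert v T)]
  have k11 : G.keep (insert v (insert w T)) = insert w K := by
    ext i
    by_cases hiv : i = v
    · subst hiv; simp [keep, delta, hv, hvw, hvK, hmv, h11]
    by_cases hiw : i = w
    · subst hiw; simp [keep, hmw]
    simp [hiv, hiw, hnot i hiv hiw (insert v (insert w T))]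
  simp only [nullity_subMat]
  rw [k00, k01, k10, k11,
    sol_00 G.adj v w K T hvw hs hvK hwK hvT hwT hrow hsame hw hwv hv hadj,
    sol_01 G.adj v w K T hvw hs hvK hwK hvT hwT hrow hsame hw hwv hv hadj,
    sol_10 G.adj v w K T hvw hvK,
    Finset.card_insert_of_notMem hwT, Finset.card_insert_of_notMem hvT,
    Finset.card_insert_of_notMem (show v ∉ insert w T by simp [hvw, hvT]),
    Finset.card_insert_of_notMem hwT, hcard, hcV]
  generalize Module.finrank (ZMod 2) (sol G.adj (insert w K) (insert v (insert w T))) = p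
  generalize Module.finrank (ZMod 2) (sol G.adj (insert w K) T) = q
  generalize Fintype.card {x : V // x ∉ ({v, w} : Finset V)} = m at *
  obtain ⟨n, rfl⟩ := Nat.exists_eq_add_of_le hle
  generalize t.card = k
  have e1 : k + n + 2 - k = n + 2 := by omega
  have e2 : k + n + 2 - (k + 1) = n + 1 := by omega
  have e3 : k + n + 2 - (k + 1 + 1) = n := by omega
  have e4 : k + n - k = n := by omega
  rw [e1, e2, e3, e4]
  generalize hP : d ^ p = P
  rw [pow_succ d p, hP]
  generalize d ^ q = Q
  subst hd'
  linear_combination (a ^ n * b ^ k * (Q + (-a^2 - b^2) * P)) * hab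

lemma entry_E1 (G : MarkedGraph V) (hs : ∀ i j, G.adj i j = G.adj j i) (v w z : V)
    (hsame : ∀ x, x ≠ v → x ≠ w → G.adj v x = G.adj w x) (hzv : z ≠ v) (hzw : z ≠ w)
    (hvz : G.adj v z = 1) (i j : V) (hiv : i ≠ v) (hiw : i ≠ w) (hiz : i ≠ z)
    (hjv : j ≠ v) (hjw : j ≠ w) :
    (G.markedPivot v z).adj i j = G.adj i j + G.adj w i * G.adj z j + G.adj z i * G.adj w j
      + (if j = z then G.adj w i * (1 + G.adj z z) else 0) := by
  have hb : ∀ a : ZMod 2, a = 0 ∨ a = 1 := by decide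
  have h1 := hsame i hiv hiw
  have h2 := hsame j hjv hjw
  by_cases hjz : j = z
  · subst hjz
    have : (G.markedPivot v j).adj i j = G.adj i v := by
      simp [markedPivot, swapAdjacencies, hiz, hiv, pivot, Equiv.swap_apply_of_ne_of_ne]
    rw [this, hs i v, h1, hs i j, ← h2, hvz]
    simp only [if_true]
    grind
  by_cases hij : i = j
  · subst hij
    have : (G.markedPivot v z).adj i i = G.adj i i := by
      simp [markedPivot, swapAdjacencies, pivot]
    rw [this]
    simp only [hjz, if_false]
    grind
  · have : (G.markedPivot v z).adj i j = (G.pivot v z).adj i j := by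
      simp [markedPivot, swapAdjacencies, hij, hiv, hiz, hjv, hjz, Equiv.swap_apply_of_ne_of_ne]
    rw [this]
    simp only [pivot, pivotCond, nbr, hij, hiv, hiz, hjv, hjz, ne_eq, not_false_iff, true_and,
      if_false, h1, h2]
    have h01 : (0 : ZMod 2) ≠ 1 := by decide
    rcases hb (G.adj w i) with e1 | e1 <;> rcases hb (G.adj w j) with e2 | e2 <;>
    rcases hb (G.adj z i) with e3 | e3 <;> rcases hb (G.adj z j) with e4 | e4 <;>
    simp [e1, e2, e3, e4] <;> try grind

lemma entry_E2 (G : MarkedGraph V) (v w z : V)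
    (hsame : ∀ x, x ≠ v → x ≠ w → G.adj v x = G.adj w x) (hzv : z ≠ v) (hzw : z ≠ w)
    (hvz : G.adj v z = 1) (j : V) (hjv : j ≠ v) (hjw : j ≠ w) :
    (G.markedPivot v z).adj z j = G.adj w j + (if j = z then 1 + G.adj z z else 0) := by
  have h2 := hsame j hjv hjw
  by_cases hjz : j = z
  · subst hjz
    have : (G.markedPivot v j).adj j j = G.adj j j := by
      simp [markedPivot, swapAdjacencies, pivot]
    rw [this, ← h2, hvz]
    simp only [if_true]
    grind
  · have : (G.markedPivot v z).adj z j = G.adj v j := by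
      simp [markedPivot, swapAdjacencies, Ne.symm hjz, hjv, hzv, hjz, pivot,
        Equiv.swap_apply_of_ne_of_ne]
    rw [this, h2]
    simp [hjz]

end MarkedGraph
open MarkedGraph Matrix in
/-- Suppose `v` and `w` are adjacent, `v` looped and marked, `w`
unlooped and unmarked, with precisely the same neighbors outside `{v,w}`.  If `v`
has no neighbor other than `w` then `⟨G⟩ = ⟨G⁺ - v - w⟩`; otherwise
`⟨G⟩ = ⟨G_c^{vz} - v - w⟩` for any neighbor `z ≠ w` of `v`. -/
theorem reducedBracket_omega2c {V : Type} [Fintype V] [DecidableEq V]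
    (G : MarkedGraph V) (hsym : G.adj.IsSymm) (v w : V) (hvw : v ≠ w)
    (hadj : G.adj v w = 1)
    (hv : G.adj v v = 1) (hmv : G.marked v = true)
    (hw : G.adj w w = 0) (hmw : G.marked w = false)
    (hsame : ∀ x, x ≠ v → x ≠ w → G.adj v x = G.adj w x) :
    ((∀ x, G.nbr v x → x = w) →
        G.reducedBracket = (G.addFreeLoop.delete {v, w}).reducedBracket) ∧
      (∀ z, z ≠ w → G.nbr v z →
        G.reducedBracket = ((G.markedPivot v z).delete {v, w}).reducedBracket) := by
  have hs : ∀ i j, G.adj i j = G.adj j i := fun i j => hsym.apply j i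
  have hb : ∀ a : ZMod 2, a = 0 ∨ a = 1 := by decide
  constructor
  · intro hn
    rw [reducedBracket_main G hsym v w hvw hadj hv hmv hw hmw hsame _ _ _ rfl rfl rfl,
      reducedBracket_eq _ _ _ _ rfl rfl rfl]
    have hfl : (G.addFreeLoop.delete {v, w}).freeLoops = G.freeLoops + 1 := rfl
    rw [hfl, pow_succ, mul_assoc]
    congr 1
    rw [Finset.mul_sum]
    refine Finset.sum_congr rfl fun t _ => ?_
    rw [nullity_delete]
    have hz : ∀ i, i ≠ v → G.adj w i = 0 := by
      intro i hiv
      by_cases hiw : i = w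
      · rw [hiw, hw]
      · rw [← hsame i hiv hiw]
        rcases hb (G.adj v i) with h | h
        · exact h
        · exact absurd (hn i ⟨hiv, h⟩) hiw
    rw [sol_iso G.adj v w _ _ hvw hs (by simp) (by simp) (not_mem_up _ t v (by simp))
      (not_mem_up _ t w (by simp)) hz]
    have hk : G.addFreeLoop.keep (up _ t) = G.keep (up _ t) := rfl
    have ha : G.addFreeLoop.adj = G.adj := rfl
    rw [hk, ha, pow_succ]
    ring
  · rintro z hzw ⟨hzv, hvz⟩
    rw [reducedBracket_main G hsym v w hvw hadj hv hmv hw hmw hsame _ _ _ rfl rfl rfl,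
      reducedBracket_eq _ _ _ _ rfl rfl rfl]
    have hfl : ((G.markedPivot v z).delete {v, w}).freeLoops = G.freeLoops := rfl
    rw [hfl]
    congr 1
    refine Finset.sum_congr rfl fun t _ => ?_
    rw [nullity_delete]
    congr 2
    have hdiag : ∀ i, (G.markedPivot v z).adj i i = G.adj i i := by
      intro i
      simp [markedPivot, swapAdjacencies, pivot]
    refine sol_pivot G.adj (G.markedPivot v z).adj v w z _ _ _ hvw hzv hzw hs
      (by rw [← hsame z hzv hzw, hvz]) hw (by simp) (by simp) (not_mem_up _ t v (by simp))
      (not_mem_up _ t w (by simp)) ?_ ?_ ?_ ?_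
    · intro u huv huw i hiv hiw hiz
      have : G.adj w i * (1 + G.adj z z) * u z
          = ∑ j, (if j = z then G.adj w i * (1 + G.adj z z) else 0) * u j := by simp
      rw [this]
      simp only [mulVec, dotProduct]
      rw [Finset.mul_sum, Finset.mul_sum, ← Finset.sum_add_distrib, ← Finset.sum_add_distrib,
        ← Finset.sum_add_distrib]
      refine Finset.sum_congr rfl fun j _ => ?_
      by_cases hjv : j = v
      · simp [hjv, huv]
      by_cases hjw : j = w
      · simp [hjw, huw]
      rw [entry_E1 G hs v w z hsame hzv hzw hvz i j hiv hiw hiz hjv hjw]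
      ring
    · intro u huv huw
      have : (1 + G.adj z z) * u z
          = ∑ j, (if j = z then (1 + G.adj z z) else 0) * u j := by simp
      rw [this]
      simp only [mulVec, dotProduct]
      rw [← Finset.sum_add_distrib]
      refine Finset.sum_congr rfl fun j _ => ?_
      by_cases hjv : j = v
      · simp [hjv, huv]
      by_cases hjw : j = w
      · simp [hjw, huw]
      rw [entry_E2 G v w z hsame hzv hzw hvz j hjv hjw]
      ring
    · intro i hiz
      by_cases hiv : i = v
      · simp [hiv]
      simp only [Finset.mem_filter, keep, Matrix.add_apply, hdiag]
      simp [markedPivot, hiv, hiz]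
    · simp only [Finset.mem_filter, mem_keep, hdiag]
      generalize G.adj z z + (if z ∈ up _ t then 1 else 0 : ZMod 2) = c
      cases hm : G.marked z <;> rcases hb c with rfl | rfl <;> simp [markedPivot, hm, hzv, hzw]
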